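/- arXiv:2412.15457 — 5 statements merged into one kernel-verified Lean document; each statement's English description precedes it below -/
import Mathlib

section
/- Let G on vertex set V (|V| = n ≥ 2) be the disjoint union of n−1 spanning arborescences A_1,...,A_{n−1}, where each A_i is a directed Hamiltonian path on V. Then G contains a rainbow spanning arborescence, i.e., a spanning arborescence using exactly one arc from each A_i. -/
open Finset

variable {V : Type*}

/-- `A` is the arc set of an arborescence on vertex set `U` rooted at `r`:
all arcs lie within `U`, the root has no incoming arc, every other vertex of `U`
has exactly one incoming arc, and every vertex of `U` is reachable from `r`. -/
def IsArborOn [DecidableEq V] (U : Finset V) (A : Finset (V × V)) (r : V) : Prop :=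
  r ∈ U ∧ (∀ e ∈ A, e.1 ∈ U ∧ e.2 ∈ U) ∧ (∀ e ∈ A, e.2 ≠ r) ∧
  (∀ v ∈ U, v ≠ r → (A.filter (fun e => e.2 = v)).card = 1) ∧
  (∀ v ∈ U, Relation.ReflTransGen (fun a b => (a, b) ∈ A) r v)

/-- A spanning arborescence on the whole (finite) vertex type. -/
def IsSpanningArbor [Fintype V] [DecidableEq V] (A : Finset (V × V)) (r : V) : Prop :=
  IsArborOn Finset.univ A r

/-- `B` is rainbow w.r.t. the colored arc sets `A 0, …, A (k-1)`:
each arc of `B` can be assigned a color whose class contains it, with all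
assigned colors distinct (i.e. at most one arc from each color). -/
def IsRainbowOf {k : ℕ} (A : Fin k → Finset (V × V)) (B : Finset (V × V)) : Prop :=
  ∃ c : V × V → Fin k, Set.InjOn c ↑B ∧ ∀ e ∈ B, e ∈ A (c e)

/-- In a spanning arborescence with exactly one leaf every vertex has at most one outgoing arc. -/
theorem IsSpanningArbor.rightUnique_of_card_leaves_eq_one [Fintype V] [DecidableEq V]
    {A : Finset (V × V)} {r : V} (hA : IsSpanningArbor A r)
    (hleaf : (Finset.univ.filter (fun v : V => ∀ e ∈ A, e.1 ≠ v)).card = 1) :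
    Relator.RightUnique (fun a b => (a, b) ∈ A) := by
  obtain ⟨-, -, hr, hin, -⟩ := hA
  have hle : A.card ≤ Fintype.card V - 1 := by
    rw [← Finset.card_univ, ← Finset.card_erase_of_mem (Finset.mem_univ r)]
    refine Finset.card_le_card_of_injOn Prod.snd (fun e he => ?_) (fun e he e' he' h => ?_)
    · simpa using hr e he
    · refine Finset.card_le_one.mp (hin e.2 (Finset.mem_univ _) (hr e he)).le e ?_ e' ?_
      · simpa using he
      · simpa using ⟨he', h.symm⟩
  have himg : (A.image Prod.fst).card = Fintype.card V - 1 := by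
    have hcompl : A.image Prod.fst = (Finset.univ.filter (fun v : V => ∀ e ∈ A, e.1 ≠ v))ᶜ := by
      ext v
      simp
    rw [hcompl, Finset.card_compl, hleaf]
  have hinj : Set.InjOn Prod.fst (A : Set (V × V)) :=
    Finset.card_image_iff.mp (le_antisymm Finset.card_image_le (hle.trans himg.ge))
  intro a b c hb hc
  exact congrArg Prod.snd (hinj hb hc rfl)

/-- Two sets closed under the arcs of a spanning path are nested. -/
theorem IsSpanningArbor.subset_or_subset_of_closed [Fintype V] [DecidableEq V]
    {A : Finset (V × V)} {r : V} (hA : IsSpanningArbor A r)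
    (hu : Relator.RightUnique (fun a b => (a, b) ∈ A)) {X Y : Finset V}
    (hX : ∀ a ∈ X, ∀ b, (a, b) ∈ A → b ∈ X) (hY : ∀ a ∈ Y, ∀ b, (a, b) ∈ A → b ∈ Y) :
    X ⊆ Y ∨ Y ⊆ X := by
  have closed_reach : ∀ Z : Finset V, (∀ a ∈ Z, ∀ b, (a, b) ∈ A → b ∈ Z) →
      ∀ a b, Relation.ReflTransGen (fun a b => (a, b) ∈ A) a b → a ∈ Z → b ∈ Z := by
    intro Z hZ a b hab ha
    induction hab with
    | refl => exact ha
    | tail _ hbc ih => exact hZ _ ih _ hbc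
  by_contra! h
  obtain ⟨a, haX, haY⟩ := Finset.not_subset.mp h.1
  obtain ⟨b, hbY, hbX⟩ := Finset.not_subset.mp h.2
  have hreach := hA.2.2.2.2
  rcases Relation.ReflTransGen.total_of_right_unique hu
    (hreach a (Finset.mem_univ a)) (hreach b (Finset.mem_univ b)) with hab | hba
  · exact hbX (closed_reach X hX a b hab haX)
  · exact haY (closed_reach Y hY b a hba hbY)

/-- Adding an arc from a vertex of an arborescence to a new vertex. -/
theorem IsArborOn.insert_arc [DecidableEq V] {U : Finset V} {B : Finset (V × V)} {r u x : V}
    (h : IsArborOn U B r) (hu : u ∈ U) (hx : x ∉ U) :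
    IsArborOn (insert x U) (insert (u, x) B) r := by
  obtain ⟨hr, hU, hroot, hin, hreach⟩ := h
  have hmono : ∀ a b, (a, b) ∈ B → (a, b) ∈ insert (u, x) B :=
    fun a b hab => Finset.mem_insert_of_mem hab
  refine ⟨Finset.mem_insert_of_mem hr, ?_, ?_, ?_, ?_⟩
  · intro e he
    rcases Finset.mem_insert.mp he with rfl | he
    · exact ⟨Finset.mem_insert_of_mem hu, Finset.mem_insert_self _ _⟩
    · exact ⟨Finset.mem_insert_of_mem (hU e he).1, Finset.mem_insert_of_mem (hU e he).2⟩
  · intro e he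
    rcases Finset.mem_insert.mp he with rfl | he
    · rintro rfl
      exact hx hr
    · exact hroot e he
  · intro v hv hvr
    rcases Finset.mem_insert.mp hv with rfl | hv
    · have hempty : B.filter (fun e => e.2 = v) = ∅ :=
        Finset.filter_eq_empty_iff.mpr fun e he hev => hx (hev ▸ (hU e he).2)
      rw [Finset.filter_insert, if_pos rfl, hempty]
      simp
    · have hxv : x ≠ v := by
        rintro rfl
        exact hx hv
      rw [Finset.filter_insert, if_neg hxv]
      exact hin v hv hvr
  · intro v hv
    rcases Finset.mem_insert.mp hv with rfl | hv
    · exact (Relation.ReflTransGen.mono hmono _ _ (hreach u hu)).tail (Finset.mem_insert_self _ _)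
    · exact Relation.ReflTransGen.mono hmono _ _ (hreach v hv)

/-- Suppose any nonempty subfamily `K` of a family of `(i + 1)`-sets covers at least `K.card + i`
vertices, and that the union of every subfamily attaining equality has an outgoing arc. Then one
can choose an outgoing arc of each member so that every subfamily attaining equality has a member
whose arc leaves the union of the subfamily. -/
theorem exists_exits [DecidableEq V] [Nonempty V] {ι : Type*} [DecidableEq ι]
    (R : V → V → Prop) (S : ι → Finset V) (i : ℕ) (J : Finset ι)
    (hcover : ∀ K ⊆ J, K.Nonempty → K.card + i ≤ (K.biUnion S).card)
    (hS : ∀ j ∈ J, (S j).card = 1 + i)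
    (hexit : ∀ K ⊆ J, K.Nonempty → (K.biUnion S).card = K.card + i →
      ∃ u ∈ K.biUnion S, ∃ x, x ∉ K.biUnion S ∧ R u x) :
    ∃ x : ι → V, (∀ j ∈ J, ∃ u ∈ S j, R u (x j)) ∧
      ∀ K ⊆ J, K.Nonempty → (K.biUnion S).card = K.card + i → ∃ j ∈ K, x j ∉ K.biUnion S := by
  induction J using Finset.strongInduction with
  | H J ih =>
  rcases J.eq_empty_or_nonempty with rfl | ⟨j₀, hj₀⟩
  · refine ⟨fun _ => Classical.arbitrary V, by simp, fun K hK hne => ?_⟩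
    exact absurd (Finset.subset_empty.mp hK) hne.ne_empty
  have restrict : ∀ J' ⊂ J, ∃ x : ι → V, (∀ j ∈ J', ∃ u ∈ S j, R u (x j)) ∧
      ∀ K ⊆ J', K.Nonempty → (K.biUnion S).card = K.card + i →
        ∃ j ∈ K, x j ∉ K.biUnion S := fun J' hJ' =>
    ih J' hJ' (fun K hK => hcover K (hK.trans hJ'.1)) (fun j hj => hS j (hJ'.1 hj))
      (fun K hK => hexit K (hK.trans hJ'.1))
  obtain ⟨M, hM, hmax⟩ := Finset.exists_max_image
    (J.powerset.filter fun K => K.Nonempty ∧ (K.biUnion S).card = K.card + i) Finset.card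
    ⟨{j₀}, by simp [hj₀, hS]⟩
  simp only [Finset.mem_filter, Finset.mem_powerset] at hM hmax
  obtain ⟨hMJ, hMne, hMtight⟩ := hM
  rcases hMJ.eq_or_ssubset with rfl | hMJ'
  · obtain ⟨u, hu, y, hy, huy⟩ := hexit M hMJ hMne hMtight
    obtain ⟨j, hj, huj⟩ := Finset.mem_biUnion.mp hu
    obtain ⟨x, hx, hxK⟩ := restrict (M.erase j) (Finset.erase_ssubset hj)
    refine ⟨Function.update x j y, fun k hk => ?_, fun K hK hne ht => ?_⟩
    · by_cases hkj : k = j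
      · subst hkj
        exact ⟨u, huj, by simpa using huy⟩
      · simpa [hkj] using hx k (Finset.mem_erase.mpr ⟨hkj, hk⟩)
    · by_cases hjK : j ∈ K
      · refine ⟨j, hjK, fun h => hy ?_⟩
        rw [Function.update_self] at h
        exact Finset.biUnion_subset_biUnion_of_subset_left S hK h
      · obtain ⟨k, hk, hkx⟩ := hxK K (Finset.subset_erase.mpr ⟨hK, hjK⟩) hne ht
        have hkj : k ≠ j := fun h => hjK (h ▸ hk)
        exact ⟨k, hk, by simpa [hkj] using hkx⟩
  · obtain ⟨x, hx, hxK⟩ := restrict M hMJ'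
    obtain ⟨y, hy, hyK⟩ := restrict (J \ M) (Finset.sdiff_ssubset hMJ hMne)
    refine ⟨fun j => if j ∈ M then x j else y j, fun k hk => ?_, fun K hK hne ht => ?_⟩
    · by_cases hkM : k ∈ M
      · simpa [hkM] using hx k hkM
      · simpa [hkM] using hy k (Finset.mem_sdiff.mpr ⟨hk, hkM⟩)
    · by_cases hKM : K ⊆ M
      · obtain ⟨k, hk, hkx⟩ := hxK K hKM hne ht
        exact ⟨k, hk, by simpa only [if_pos (hKM hk)] using hkx⟩
      by_cases hdisj : Disjoint K M
      · obtain ⟨k, hk, hky⟩ := hyK K (Finset.subset_sdiff.mpr ⟨hK, hdisj⟩) hne ht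
        exact ⟨k, hk, by simpa only [if_neg (Finset.disjoint_left.mp hdisj hk)] using hky⟩
      exfalso
      have hinter := hcover (K ∩ M) (Finset.inter_subset_left.trans hK)
        (Finset.not_disjoint_iff_nonempty_inter.mp hdisj)
      have hunion := hcover (K ∪ M) (Finset.union_subset hK hMJ) (hne.mono Finset.subset_union_left)
      have hsub : (K ∩ M).biUnion S ⊆ K.biUnion S ∩ M.biUnion S := Finset.subset_inter
        (Finset.biUnion_subset_biUnion_of_subset_left S Finset.inter_subset_left)
        (Finset.biUnion_subset_biUnion_of_subset_left S Finset.inter_subset_right)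
      have hsub_card := Finset.card_le_card hsub
      have hsplit := Finset.card_union_add_card_inter (K.biUnion S) (M.biUnion S)
      rw [← Finset.union_biUnion] at hsplit
      have hcard := Finset.card_union_add_card_inter K M
      have hle := hmax (K ∪ M) ⟨Finset.union_subset hK hMJ, hne.mono Finset.subset_union_left,
        by omega⟩
      have heq := Finset.eq_of_subset_of_card_le (Finset.subset_union_right (s₁ := K)) hle
      exact hKM (heq ▸ Finset.subset_union_left)

/-- If `n - i` sets of size `i + 1` in an `n`-set are such that any nonempty subfamily `K` covers
at least `K.card + i` vertices, then all but one of them can be extended along arcs of a given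
spanning path so that any nonempty subfamily `K` of the extended sets covers at least
`K.card + (i + 1)` vertices. -/
theorem exists_extension_along_path [Fintype V] [DecidableEq V] {A : Finset (V × V)} {r : V}
    (hA : IsSpanningArbor A r) (hu : Relator.RightUnique (fun a b => (a, b) ∈ A))
    {ι : Type*} [DecidableEq ι] (S : ι → Finset V) (i : ℕ) (J : Finset ι) (hJ : J.Nonempty)
    (hJcard : J.card + i = Fintype.card V)
    (hcover : ∀ K ⊆ J, K.Nonempty → K.card + i ≤ (K.biUnion S).card)
    (hS : ∀ j ∈ J, (S j).card = 1 + i) :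
    ∃ j ∈ J, ∃ x : ι → V, (∀ k ∈ J.erase j, x k ∉ S k ∧ ∃ u ∈ S k, (u, x k) ∈ A) ∧
      ∀ K ⊆ J.erase j, K.Nonempty →
        K.card + (i + 1) ≤ (K.biUnion fun k => insert (x k) (S k)).card := by
  classical
  have : Nonempty V := ⟨r⟩
  obtain ⟨M, hM, hmin⟩ := Finset.exists_min_image
    (J.powerset.filter fun K => K.Nonempty ∧ (K.biUnion S).card = K.card + i ∧
      ∀ a ∈ K.biUnion S, ∀ b, (a, b) ∈ A → b ∈ K.biUnion S) Finset.card
    ⟨J, by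
      have hle := hcover J subset_rfl hJ
      have huniv : J.biUnion S = Finset.univ :=
        (Finset.card_eq_iff_eq_univ _).mp (le_antisymm (Finset.card_le_univ _) (hJcard ▸ hle))
      rw [Finset.mem_filter, huniv]
      simp [hJ, hJcard]⟩
  simp only [Finset.mem_filter, Finset.mem_powerset] at hM hmin
  obtain ⟨hMJ, ⟨j, hjM⟩, hMtight, hMclosed⟩ := hM
  have nested : ∀ K ⊆ J, ∀ L ⊆ J, K.Nonempty → (L.biUnion S).card = L.card + i →
      K.biUnion S ⊆ L.biUnion S → K ⊆ L := by
    intro K hK L hL hKne hLtight hsub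
    have hle := hcover (K ∪ L) (Finset.union_subset hK hL) (hKne.mono Finset.subset_union_left)
    rw [Finset.union_biUnion, Finset.union_eq_right.mpr hsub, hLtight] at hle
    have heq := Finset.eq_of_subset_of_card_le (Finset.subset_union_right (s₁ := K))
      (Nat.le_of_add_le_add_right hle)
    exact heq ▸ Finset.subset_union_left
  have hsub : J.erase j ⊆ J := Finset.erase_subset j J
  obtain ⟨x, hx, hxK⟩ := exists_exits (fun a b => (a, b) ∈ A) S i (J.erase j)
    (fun K hK => hcover K (hK.trans hsub)) (fun k hk => hS k (hsub hk)) (by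
      intro K hK hne ht
      by_contra! hclosed
      have hKclosed : ∀ a ∈ K.biUnion S, ∀ b, (a, b) ∈ A → b ∈ K.biUnion S := by
        intro a ha b hab
        by_contra hb
        exact hclosed a ha b hb hab
      have hjK : j ∉ K := fun h => Finset.notMem_erase j J (hK h)
      rcases hA.subset_or_subset_of_closed hu hMclosed hKclosed with h | h
      · exact hjK (nested M hMJ K (hK.trans hsub) ⟨j, hjM⟩ ht h hjM)
      · have hKM := nested K (hK.trans hsub) M hMJ hne hMtight h
        have heq := Finset.eq_of_subset_of_card_le hKM
          (hmin K ⟨hK.trans hsub, hne, ht, hKclosed⟩)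
        exact hjK (heq ▸ hjM))
  refine ⟨j, hMJ hjM, x, fun k hk => ⟨?_, hx k hk⟩, fun K hK hne => ?_⟩
  · obtain ⟨l, hl, hlx⟩ := hxK {k} (by simpa using hk) (Finset.singleton_nonempty k)
      (by simp [hS k (hsub hk)])
    rw [Finset.mem_singleton] at hl
    simpa [hl] using hlx
  · have hmono : K.biUnion S ⊆ K.biUnion fun k => insert (x k) (S k) :=
      Finset.biUnion_mono fun k _ => Finset.subset_insert _ _
    have hle := hcover K (hK.trans hsub) hne
    by_cases ht : (K.biUnion S).card = K.card + i
    · obtain ⟨k, hk, hkx⟩ := hxK K hK hne ht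
      have hins : insert (x k) (K.biUnion S) ⊆ K.biUnion fun k => insert (x k) (S k) :=
        Finset.insert_subset
          (Finset.mem_biUnion.mpr ⟨k, hk, Finset.mem_insert_self _ _⟩) hmono
      have hcard := Finset.card_le_card hins
      rw [Finset.card_insert_of_notMem hkx] at hcard
      omega
    · have hcard := Finset.card_le_card hmono
      omega

/-- For `i` spanning paths on `n` vertices, at least `n - i` vertices are roots of arborescences
on `i + 1` vertices using one arc of each path. -/
theorem exists_rainbow_arborescences [Fintype V] [DecidableEq V] {k : ℕ}
    (hk : k < Fintype.card V) (A : Fin k → Finset (V × V)) (r : Fin k → V)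
    (hA : ∀ i, IsSpanningArbor (A i) (r i))
    (hu : ∀ i, Relator.RightUnique (fun a b => (a, b) ∈ A i)) (c₀ : V × V → Fin k)
    (i : ℕ) (hi : i ≤ k) :
    ∃ (J : Finset V) (S : V → Finset V), J.card + i = Fintype.card V ∧
      (∀ K ⊆ J, K.Nonempty → K.card + i ≤ (K.biUnion S).card) ∧
      (∀ j ∈ J, (S j).card = 1 + i) ∧
      ∀ j ∈ J, ∃ (B : Finset (V × V)) (c : V × V → Fin k), IsArborOn (S j) B j ∧
        Set.InjOn c ↑B ∧ ∀ e ∈ B, e ∈ A (c e) ∧ (c e : ℕ) < i := by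
  induction i with
  | zero =>
    refine ⟨Finset.univ, fun v => {v}, by simp, by simp, by simp, fun j _ => ⟨∅, c₀, ?_⟩⟩
    refine ⟨⟨by simp, by simp, by simp, by simp, fun v hv => ?_⟩, by simp, by simp⟩
    rw [Finset.mem_singleton.mp hv]
  | succ i ih =>
    obtain ⟨J, S, hJcard, hcover, hS, hB⟩ := ih (by omega)
    let p : Fin k := ⟨i, hi⟩
    obtain ⟨j, hj, x, hx, hcover'⟩ := exists_extension_along_path (hA p) (hu p) S i J
      (Finset.card_pos.mp (by omega)) hJcard hcover hS
    refine ⟨J.erase j, fun l => insert (x l) (S l), ?_, hcover', fun l hl => ?_, fun l hl => ?_⟩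
    · have hcard := Finset.card_erase_add_one hj
      omega
    · rw [Finset.card_insert_of_notMem (hx l hl).1, hS l (Finset.mem_of_mem_erase hl)]
      omega
    · obtain ⟨hxl, u, hul, hux⟩ := hx l hl
      obtain ⟨B, c, hBl, hinj, hc⟩ := hB l (Finset.mem_of_mem_erase hl)
      have hnot : (u, x l) ∉ B := fun h => hxl (hBl.2.1 _ h).2
      have hne : ∀ e ∈ B, e ≠ (u, x l) := fun e he h => hnot (h ▸ he)
      refine ⟨insert (u, x l) B, Function.update c (u, x l) p, hBl.insert_arc hul hxl, ?_, ?_⟩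
      · have heq : Set.EqOn (Function.update c (u, x l) p) c ↑B := fun e he =>
          Function.update_of_ne (hne e he) _ _
        rw [Finset.coe_insert, Set.injOn_insert (by simpa using hnot)]
        refine ⟨hinj.congr heq.symm, ?_⟩
        rintro ⟨e, he, hep⟩
        rw [heq he, Function.update_self] at hep
        have hlt := (hc e he).2
        rw [hep] at hlt
        exact lt_irrefl i hlt
      · intro e he
        rcases Finset.mem_insert.mp he with rfl | he
        · rw [Function.update_self]
          exact ⟨hux, Nat.lt_succ_self i⟩
        · rw [Function.update_of_ne (hne e he)]
          exact ⟨(hc e he).1, (hc e he).2.trans (Nat.lt_succ_self i)⟩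

theorem stmt5 [Fintype V] [DecidableEq V] (hn : 2 ≤ Fintype.card V)
    (A : Fin (Fintype.card V - 1) → Finset (V × V)) (r : Fin (Fintype.card V - 1) → V)
    (hA : ∀ i, IsSpanningArbor (A i) (r i))
    (hpath : ∀ i, (Finset.univ.filter (fun v : V => ∀ e ∈ A i, e.1 ≠ v)).card = 1) :
    ∃ (B : Finset (V × V)) (r' : V), IsSpanningArbor B r' ∧ IsRainbowOf A B := by
  obtain ⟨J, S, hJcard, -, hS, hB⟩ := exists_rainbow_arborescences (by omega) A r hA
    (fun i => (hA i).rightUnique_of_card_leaves_eq_one (hpath i)) (fun _ => ⟨0, by omega⟩)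
    (Fintype.card V - 1) le_rfl
  obtain ⟨j, hj⟩ : J.Nonempty := Finset.card_pos.mp (by omega)
  obtain ⟨B, c, hBj, hinj, hc⟩ := hB j hj
  have huniv : S j = Finset.univ :=
    (Finset.card_eq_iff_eq_univ _).mp (by rw [hS j hj]; omega)
  rw [huniv] at hBj
  exact ⟨B, j, hBj, c, hinj, fun e he => (hc e he).1⟩
end

section
/- Let G on vertex set V (|V| = n ≥ 2) be the disjoint union of n−1 spanning arborescences A_1,...,A_{n−1}, where each A_i is either a path (arborescence with exactly one leaf) or a star (arborescence in which every non-root vertex is a leaf). Then G contains a rainbow spanning arborescence. -/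
open Finset

variable {V : Type*}

open Relation

section Arborescence

variable [Fintype V] [DecidableEq V] {A : Finset (V × V)} {r : V}

/-- `v` is a descendant of `u` along the arcs of `A`. -/
def Reaches (A : Finset (V × V)) : V → V → Prop :=
  ReflTransGen fun a b => (a, b) ∈ A

theorem IsSpanningArbor.parent_unique (h : IsSpanningArbor A r) {a b v : V}
    (ha : (a, v) ∈ A) (hb : (b, v) ∈ A) : a = b := by
  have hcard := h.2.2.2.1 v (mem_univ v) (h.2.2.1 _ ha)
  have := card_le_one.1 hcard.le (a, v) (by simp [ha]) (b, v) (by simp [hb])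
  exact congrArg Prod.fst this

theorem IsSpanningArbor.exists_parent (h : IsSpanningArbor A r) {v : V} (hv : v ≠ r) :
    ∃ a, (a, v) ∈ A := by
  obtain ⟨⟨a, b⟩, hab⟩ := card_pos.1 (h.2.2.2.1 v (mem_univ v) hv ▸ Nat.one_pos)
  obtain ⟨hA, rfl⟩ := mem_filter.1 hab
  exact ⟨a, hA⟩

theorem IsSpanningArbor.acyclic (h : IsSpanningArbor A r) (v : V) :
    ¬ TransGen (fun a b => (a, b) ∈ A) v v := by
  induction h.2.2.2.2 v (mem_univ v) with
  | refl =>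
    intro hr
    obtain ⟨b, -, hb⟩ := TransGen.tail'_iff.1 hr
    exact h.2.2.1 _ hb rfl
  | tail _ hbc ih =>
    intro hc
    obtain ⟨b', hcb, hb⟩ := TransGen.tail'_iff.1 hc
    obtain rfl := h.parent_unique hb hbc
    exact ih (TransGen.head' hbc hcb)

open Classical in
/-- The number of descendants of `v` in `A`. -/
noncomputable def descCard (A : Finset (V × V)) (v : V) : ℕ :=
  #{w | Reaches A v w}

theorem IsSpanningArbor.descCard_lt (h : IsSpanningArbor A r) {a v : V} (hav : (a, v) ∈ A) :
    descCard A v < descCard A a := by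
  classical
  refine card_lt_card (ssubset_iff_of_subset ?_ |>.2 ⟨a, ?_, ?_⟩)
  · intro w hw
    simp only [mem_filter, mem_univ, true_and] at hw ⊢
    exact ReflTransGen.head hav hw
  · exact mem_filter.2 ⟨mem_univ a, ReflTransGen.refl⟩
  · intro hw
    simp only [mem_filter, mem_univ, true_and] at hw
    exact h.acyclic a (TransGen.head' hav hw)

theorem IsSpanningArbor.descCard_lt_of_reaches (h : IsSpanningArbor A r) {a v : V}
    (hav : Reaches A a v) (hne : v ≠ a) : descCard A v < descCard A a := by
  induction hav with
  | refl => exact absurd rfl hne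
  | @tail b c _ hbc ih =>
    by_cases hb : b = a
    · exact hb ▸ h.descCard_lt hbc
    · exact (h.descCard_lt hbc).trans (ih hb)

theorem IsSpanningArbor.reaches_leaf (h : IsSpanningArbor A r) {l : V}
    (hl : ∀ v, (∀ e ∈ A, e.1 ≠ v) → v = l) (v : V) : Reaches A v l := by
  induction hk : descCard A v using Nat.strong_induction_on generalizing v with
  | _ k ih =>
    by_cases hv : ∀ e ∈ A, e.1 ≠ v
    · exact hl v hv ▸ ReflTransGen.refl
    · push Not at hv
      obtain ⟨⟨a, b⟩, he, rfl⟩ := hv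
      exact ReflTransGen.head he (ih _ (hk ▸ h.descCard_lt he) b rfl)

/-- In a path, any two vertices are comparable. -/
theorem IsSpanningArbor.reaches_total (h : IsSpanningArbor A r)
    (hleaf : #{v : V | ∀ e ∈ A, e.1 ≠ v} = 1) (u v : V) : Reaches A u v ∨ Reaches A v u := by
  obtain ⟨l, hl⟩ := card_eq_one.1 hleaf
  have hl' : ∀ v, (∀ e ∈ A, e.1 ≠ v) → v = l := fun v hv =>
    mem_singleton.1 (hl ▸ mem_filter.2 ⟨mem_univ v, hv⟩)
  have hu := reflTransGen_swap.2 (h.reaches_leaf hl' u)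
  have hv := reflTransGen_swap.2 (h.reaches_leaf hl' v)
  refine (ReflTransGen.total_of_right_unique ?_ hu hv).symm.imp
    reflTransGen_swap.1 reflTransGen_swap.1
  exact fun _ _ _ ha hb => h.parent_unique ha hb

end Arborescence

section Growing

variable [DecidableEq V] {S : Finset V} {B : Finset (V × V)} {s : V}

theorem IsArborOn.filter_eq_empty (h : IsArborOn S B s) {v : V} (hv : v ∉ S ∨ v = s) :
    B.filter (fun e => e.2 = v) = ∅ := by
  refine filter_eq_empty_iff.2 fun e he hev => ?_
  rcases hv with hv | hv
  · exact hv (hev ▸ (h.2.1 e he).2)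
  · exact h.2.2.1 e he (hev.trans hv)

theorem IsArborOn.insert_leaf (h : IsArborOn S B s) {p w : V} (hp : p ∈ S) (hw : w ∉ S) :
    IsArborOn (insert w S) (insert (p, w) B) s := by
  have hmono : ∀ v ∈ S, ReflTransGen (fun a b => (a, b) ∈ insert (p, w) B) s v := fun v hv =>
    ReflTransGen.mono (fun _ _ hab => mem_insert_of_mem hab) _ _ (h.2.2.2.2 v hv)
  refine ⟨mem_insert_of_mem h.1, ?_, ?_, ?_, ?_⟩
  · intro e he
    rcases mem_insert.1 he with rfl | he
    · exact ⟨mem_insert_of_mem hp, mem_insert_self _ _⟩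
    · exact ⟨mem_insert_of_mem (h.2.1 e he).1, mem_insert_of_mem (h.2.1 e he).2⟩
  · intro e he
    rcases mem_insert.1 he with rfl | he
    · exact (ne_of_mem_of_not_mem h.1 hw).symm
    · exact h.2.2.1 e he
  · intro v hv hvs
    rw [filter_insert]
    rcases mem_insert.1 hv with rfl | hv
    · simp [h.filter_eq_empty (Or.inl hw)]
    · rw [if_neg (ne_of_mem_of_not_mem hv hw).symm]
      exact h.2.2.2.1 v hv hvs
  · intro v hv
    rcases mem_insert.1 hv with rfl | hv
    · exact (hmono p hp).tail (mem_insert_self _ _)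
    · exact hmono v hv

theorem IsArborOn.insert_root (h : IsArborOn S B s) {w : V} (hw : w ∉ S) :
    IsArborOn (insert w S) (insert (w, s) B) w := by
  have hsw : s ≠ w := fun hsw => hw (hsw ▸ h.1)
  refine ⟨mem_insert_self _ _, ?_, ?_, ?_, ?_⟩
  · intro e he
    rcases mem_insert.1 he with rfl | he
    · exact ⟨mem_insert_self _ _, mem_insert_of_mem h.1⟩
    · exact ⟨mem_insert_of_mem (h.2.1 e he).1, mem_insert_of_mem (h.2.1 e he).2⟩
  · intro e he
    rcases mem_insert.1 he with rfl | he
    · exact hsw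
    · exact fun hew => hw (hew ▸ (h.2.1 e he).2)
  · intro v hv hvw
    have hvS := mem_of_mem_insert_of_ne hv hvw
    rw [filter_insert]
    by_cases hvs : v = s
    · subst hvs
      simp [h.filter_eq_empty (Or.inr rfl)]
    · rw [if_neg (Ne.symm hvs)]
      exact h.2.2.2.1 v hvS hvs
  · intro v hv
    rcases mem_insert.1 hv with rfl | hv
    · exact ReflTransGen.refl
    · exact ReflTransGen.head (mem_insert_self _ _)
        (ReflTransGen.mono (fun _ _ hab => mem_insert_of_mem hab) _ _ (h.2.2.2.2 v hv))

end Growing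

theorem Finset.exists_nonempty_subset_image_eq {κ : Type*} [DecidableEq κ] (g : κ → κ)
    (X : Finset κ) (hX : X.Nonempty) (hg : ∀ i ∈ X, g i ∈ X) :
    ∃ Y ⊆ X, Y.Nonempty ∧ Y.image g = Y := by
  induction X using Finset.strongInduction with
  | H X ih =>
    have hsub : X.image g ⊆ X := image_subset_iff.2 hg
    by_cases heq : X.image g = X
    · exact ⟨X, Subset.rfl, hX, heq⟩
    · obtain ⟨Y, hY, hne, himg⟩ := ih _ (hsub.ssubset_of_ne heq) (hX.image g)
        fun i hi => mem_image_of_mem g (hsub hi)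
      exact ⟨Y, hY.trans hsub, hne, himg⟩

section Rainbow

variable {κ : Type*} [DecidableEq κ] [Fintype V] [DecidableEq V]
  {A : κ → Finset (V × V)} {r : κ → V} {J : Finset κ}

/-- Some arborescence uses exactly one arc `e i ∈ A i` of each colour `i ∈ J`, and no others. -/
def HasRainbowArbor (A : κ → Finset (V × V)) (J : Finset κ) : Prop :=
  ∃ (S : Finset V) (s : V) (e : κ → V × V), Set.InjOn e J ∧ (∀ i ∈ J, e i ∈ A i) ∧
    IsArborOn S (J.image e) s ∧ #S = #J + 1

/-- Let the colours pick, one after another, the last vertex on their path not yet picked. -/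
theorem exists_injOn_forall_notMem_image_reaches (hA : ∀ i, IsSpanningArbor (A i) (r i))
    (hpath : ∀ i ∈ J, ∀ u v, Reaches (A i) u v ∨ Reaches (A i) v u)
    (hJ : #J < Fintype.card V) :
    ∃ σ : κ → V, Set.InjOn σ J ∧ ∀ i ∈ J, ∀ v ∉ J.image σ, Reaches (A i) v (σ i) := by
  induction J using Finset.induction_on with
  | empty =>
    obtain ⟨v⟩ := Fintype.card_pos_iff.1 (hJ.trans_le' (Nat.zero_le _))
    exact ⟨fun _ => v, by simp, by simp⟩
  | insert i J hi ih =>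
    rw [card_insert_of_notMem hi] at hJ
    obtain ⟨σ, hinj, hσ⟩ := ih (fun i hi => hpath i (mem_insert_of_mem hi)) (by omega)
    have hne : ((J.image σ)ᶜ).Nonempty := by
      rw [← card_pos, card_compl]
      have := card_image_le (s := J) (f := σ)
      omega
    obtain ⟨m, hm, hmin⟩ := exists_min_image _ (descCard (A i)) hne
    rw [mem_compl] at hm
    have himg : J.image (Function.update σ i m) = J.image σ :=
      image_congr fun j hj => Function.update_of_ne (ne_of_mem_of_not_mem hj hi) _ _
    refine ⟨Function.update σ i m, ?_, ?_⟩
    · rw [coe_insert, Set.injOn_insert (by simpa using hi)]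
      refine ⟨hinj.congr fun j hj => (Function.update_of_ne (ne_of_mem_of_not_mem hj hi) _ _).symm, ?_⟩
      rw [Function.update_self, ← coe_image, himg]
      exact_mod_cast hm
    · intro j hj v hv
      rw [image_insert, himg, Function.update_self, mem_insert, not_or] at hv
      rcases mem_insert.1 hj with rfl | hj
      · rw [Function.update_self]
        refine (hpath j (mem_insert_self _ _) v m).resolve_right fun hmv => ?_
        exact ((hA j).descCard_lt_of_reaches hmv hv.1).not_ge (hmin v (mem_compl.2 hv.2))
      · rw [Function.update_of_ne (ne_of_mem_of_not_mem hj hi)]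
        exact hσ j hj v hv.2

/-- `σ` picks for each colour `i ∈ J` its own vertex, a proper descendant of `s` in `A i`. -/
def IsHeadChoice (A : κ → Finset (V × V)) (J : Finset κ) (s : V) (σ : κ → V) : Prop :=
  Set.InjOn σ J ∧ ∀ i ∈ J, Reaches (A i) s (σ i) ∧ σ i ≠ s

/-- In a choice of heads with the most descendants, the tails are heads themselves or the root,
and following tails upwards never runs into a cycle. -/
theorem hasRainbowArbor_of_isHeadChoice [Fintype κ] (hA : ∀ i, IsSpanningArbor (A i) (r i))
    {s : V} (hex : ∃ σ, IsHeadChoice A J s σ) : HasRainbowArbor A J := by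
  classical
  obtain ⟨σ, hσ, hmax⟩ := exists_max_image {σ : κ → V | IsHeadChoice A J s σ}
    (fun σ => ∑ i ∈ J, descCard (A i) (σ i)) (by simpa [Finset.Nonempty] using hex)
  simp only [mem_filter, mem_univ, true_and] at hσ hmax
  obtain ⟨hinj, hσ⟩ := hσ
  have htail : ∀ i, ∃ a, i ∈ J → (a, σ i) ∈ A i ∧ Reaches (A i) s a := by
    intro i
    by_cases hi : i ∈ J
    · rcases ReflTransGen.cases_tail (hσ i hi).1 with h | ⟨a, ha, haσ⟩
      · exact absurd h (hσ i hi).2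
      · exact ⟨a, fun _ => ⟨haσ, ha⟩⟩
    · exact ⟨s, fun h => absurd h hi⟩
  choose p hp using htail
  have himprove : ∀ Y ⊆ J, Y.Nonempty → (∀ i ∈ Y, p i ≠ s) →
      ¬ Set.InjOn (fun i => if i ∈ Y then p i else σ i) J := by
    intro Y hY ⟨i₀, hi₀⟩ hps hinj'
    refine (hmax _ ⟨hinj', fun i hi => ?_⟩).not_gt (sum_lt_sum (fun i hi => ?_) ⟨i₀, hY hi₀, ?_⟩)
    · split_ifs with hiY
      · exact ⟨(hp i hi).2, hps i hiY⟩
      · exact hσ i hi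
    · split_ifs
      · exact ((hA i).descCard_lt (hp i hi).1).le
      · exact le_rfl
    · rw [if_pos hi₀]
      exact (hA i₀).descCard_lt (hp i₀ (hY hi₀)).1
  have hclosed : ∀ i ∈ J, p i ≠ s → ∃ j ∈ J, σ j = p i := by
    intro i hi hps
    by_contra! hno
    refine himprove {i} (by simpa using hi) (singleton_nonempty i) (by simpa using hps) ?_
    intro j hj k hk hjk
    simp only [mem_singleton] at hjk
    split_ifs at hjk with h₁ h₂ h₂
    · exact h₁.trans h₂.symm
    · exact absurd (h₁ ▸ hjk).symm (hno k hk)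
    · exact absurd (h₂ ▸ hjk) (hno j hj)
    · exact hinj hj hk hjk
  have hsnd : Set.InjOn (fun i => (p i, σ i)) J := fun i hi j hj hij =>
    hinj hi hj (congrArg Prod.snd hij)
  have hreach : ∀ i ∈ J, Reaches (J.image fun i => (p i, σ i)) s (σ i) := by
    by_contra! hbad
    set X := J.filter fun i => ¬ Reaches (J.image fun i => (p i, σ i)) s (σ i)
    have hX : X.Nonempty := by
      obtain ⟨i, hi, hr⟩ := hbad
      exact ⟨i, mem_filter.2 ⟨hi, hr⟩⟩
    have hXp : ∀ i ∈ X, ¬ Reaches (J.image fun i => (p i, σ i)) s (p i) := fun i hi hr =>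
      (mem_filter.1 hi).2 (hr.tail (mem_image_of_mem _ (mem_filter.1 hi).1))
    have hXs : ∀ i ∈ X, p i ≠ s := fun i hi h => hXp i hi (h ▸ ReflTransGen.refl)
    have hg : ∀ i, ∃ j, i ∈ X → j ∈ X ∧ σ j = p i := by
      intro i
      by_cases hi : i ∈ X
      · obtain ⟨j, hj, hji⟩ := hclosed i (mem_filter.1 hi).1 (hXs i hi)
        exact ⟨j, fun _ => ⟨mem_filter.2 ⟨hj, hji ▸ hXp i hi⟩, hji⟩⟩
      · exact ⟨i, fun h => absurd h hi⟩
    choose g hg using hg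
    obtain ⟨Y, hYX, hY, hYg⟩ :=
      Finset.exists_nonempty_subset_image_eq g X hX fun i hi => (hg i hi).1
    have hgY : ∀ i ∈ Y, g i ∈ Y := fun i hi => hYg ▸ mem_image_of_mem g hi
    have hginj : Set.InjOn g Y := card_image_iff.1 (congrArg card hYg)
    have hYJ : Y ⊆ J := hYX.trans (filter_subset _ _)
    refine himprove Y hYJ hY (fun i hi => hXs i (hYX hi)) ?_
    intro j hj k hk hjk
    dsimp only at hjk
    split_ifs at hjk with h₁ h₂ h₂
    · rw [← (hg j (hYX h₁)).2, ← (hg k (hYX h₂)).2] at hjk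
      exact hginj h₁ h₂ (hinj (hYJ (hgY j h₁)) (hYJ (hgY k h₂)) hjk)
    · rw [← (hg j (hYX h₁)).2] at hjk
      exact absurd (hinj (hYJ (hgY j h₁)) hk hjk ▸ hgY j h₁) h₂
    · rw [← (hg k (hYX h₂)).2] at hjk
      exact absurd (hinj hj (hYJ (hgY k h₂)) hjk ▸ hgY k h₂) h₁
    · exact hinj hj hk hjk
  refine ⟨insert s (J.image σ), s, fun i => (p i, σ i), hsnd, fun i hi => (hp i hi).1,
    ⟨mem_insert_self _ _, ?_, ?_, ?_, ?_⟩, ?_⟩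
  · rw [forall_mem_image]
    refine fun i hi => ⟨?_, mem_insert_of_mem (mem_image_of_mem σ hi)⟩
    by_cases hps : p i = s
    · simp [hps]
    · exact mem_insert_of_mem (mem_image.2 (hclosed i hi hps))
  · rw [forall_mem_image]
    exact fun i hi => (hσ i hi).2
  · intro v hv hvs
    obtain ⟨i, hi, rfl⟩ := mem_image.1 (mem_of_mem_insert_of_ne hv hvs)
    refine card_eq_one.2 ⟨(p i, σ i), eq_singleton_iff_unique_mem.2 ⟨?_, ?_⟩⟩
    · exact mem_filter.2 ⟨mem_image_of_mem _ hi, rfl⟩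
    · intro e he
      obtain ⟨he, hei⟩ := mem_filter.1 he
      obtain ⟨j, hj, rfl⟩ := mem_image.1 he
      rw [hinj hj hi hei]
  · intro v hv
    rcases mem_insert.1 hv with rfl | hv
    · exact ReflTransGen.refl
    · obtain ⟨i, hi, rfl⟩ := mem_image.1 hv
      exact hreach i hi
  · rw [card_insert_of_notMem, card_image_of_injOn hinj]
    intro hs
    obtain ⟨i, hi, his⟩ := mem_image.1 hs
    exact (hσ i hi).2 his

theorem hasRainbowArbor_of_paths [Fintype κ] (hA : ∀ i, IsSpanningArbor (A i) (r i))
    (hpath : ∀ i ∈ J, ∀ u v, Reaches (A i) u v ∨ Reaches (A i) v u)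
    (hJ : #J < Fintype.card V) : HasRainbowArbor A J := by
  obtain ⟨σ, hinj, hσ⟩ := exists_injOn_forall_notMem_image_reaches hA hpath hJ
  obtain ⟨s, hs⟩ : ∃ s, s ∉ J.image σ := by
    by_contra! hall
    have := card_image_le (s := J) (f := σ)
    rw [eq_univ_iff_forall.2 hall, card_univ] at this
    omega
  exact hasRainbowArbor_of_isHeadChoice hA
    ⟨σ, hinj, fun i hi => ⟨hσ i hi s hs, fun h => hs (h ▸ mem_image_of_mem σ hi)⟩⟩

theorem IsSpanningArbor.mem_of_star {B : Finset (V × V)} {c : V} (h : IsSpanningArbor B c)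
    (hstar : ∀ e ∈ B, e.1 = c) {v : V} (hv : v ≠ c) : (c, v) ∈ B := by
  obtain ⟨a, ha⟩ := h.exists_parent hv
  obtain rfl : a = c := hstar _ ha
  exact ha

/-- An arborescence that is not spanning can always be extended by an arc of a star. -/
theorem HasRainbowArbor.insert_star (h : HasRainbowArbor A J) {i : κ} (hi : i ∉ J)
    (hAi : IsSpanningArbor (A i) (r i)) (hstar : ∀ e ∈ A i, e.1 = r i)
    (hJ : #J + 1 < Fintype.card V) : HasRainbowArbor A (insert i J) := by
  obtain ⟨S, s, e, hinj, heA, harb, hcard⟩ := h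
  have hext : ∃ (w s' : V) (a : V × V), w ∉ S ∧ a ∈ A i ∧ a ∉ J.image e ∧
      IsArborOn (insert w S) (insert a (J.image e)) s' := by
    by_cases hc : r i ∈ S
    · obtain ⟨w, hw⟩ : ∃ w, w ∉ S := by
        by_contra! hall
        rw [eq_univ_iff_forall.2 hall, card_univ] at hcard
        omega
      exact ⟨w, s, (r i, w), hw, hAi.mem_of_star hstar fun h => hw (h ▸ hc),
        fun h => hw (harb.2.1 _ h).2, harb.insert_leaf hc hw⟩
    · exact ⟨r i, r i, (r i, s), hc, hAi.mem_of_star hstar fun h => hc (h ▸ harb.1),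
        fun h => hc (harb.2.1 _ h).1, harb.insert_root hc⟩
  obtain ⟨w, s', a, hw, haA, haB, harb'⟩ := hext
  have hne : ∀ j ∈ J, Function.update e i a j = e j := fun j hj =>
    Function.update_of_ne (ne_of_mem_of_not_mem hj hi) _ _
  have himg : J.image (Function.update e i a) = J.image e := image_congr hne
  refine ⟨insert w S, s', Function.update e i a, ?_, ?_, ?_, ?_⟩
  · rw [coe_insert, Set.injOn_insert (by simpa using hi)]
    refine ⟨hinj.congr fun j hj => (hne j hj).symm, ?_⟩
    rw [Function.update_self, ← coe_image, himg]
    exact_mod_cast haB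
  · intro j hj
    rcases mem_insert.1 hj with rfl | hj
    · rwa [Function.update_self]
    · rw [hne j hj]
      exact heA j hj
  · rwa [image_insert, himg, Function.update_self]
  · rw [card_insert_of_notMem hw, card_insert_of_notMem hi, hcard]

end Rainbow

theorem stmt6 [Fintype V] [DecidableEq V] (hn : 2 ≤ Fintype.card V)
    (A : Fin (Fintype.card V - 1) → Finset (V × V)) (r : Fin (Fintype.card V - 1) → V)
    (hA : ∀ i, IsSpanningArbor (A i) (r i))
    (hps : ∀ i, (Finset.univ.filter (fun v : V => ∀ e ∈ A i, e.1 ≠ v)).card = 1 ∨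
      ∀ e ∈ A i, e.1 = r i) :
    ∃ (B : Finset (V × V)) (r' : V), IsSpanningArbor B r' ∧ IsRainbowOf A B := by
  have hlt : ∀ J : Finset (Fin (Fintype.card V - 1)), #J < Fintype.card V := fun J => by
    have := card_le_univ J
    rw [Fintype.card_fin] at this
    omega
  let P : Finset (Fin (Fintype.card V - 1)) :=
    univ.filter fun i => #{v : V | ∀ e ∈ A i, e.1 ≠ v} = 1
  have hall : ∀ K, HasRainbowArbor A (P ∪ K) := by
    intro K
    induction K using Finset.induction_on with
    | empty =>
      rw [union_empty]
      exact hasRainbowArbor_of_paths hA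
        (fun i hi => (hA i).reaches_total (mem_filter.1 hi).2) (hlt P)
    | insert i K _ ih =>
      rw [union_insert]
      by_cases hi : i ∈ P ∪ K
      · rwa [insert_eq_of_mem hi]
      · have hstar := (hps i).resolve_left fun h =>
          hi (mem_union_left _ (mem_filter.2 ⟨mem_univ i, h⟩))
        refine ih.insert_star hi (hA i) hstar ?_
        rw [← card_insert_of_notMem hi]
        exact hlt _
  obtain ⟨S, s, e, hinj, heA, harb, hcard⟩ := hall univ
  rw [union_eq_right.2 (subset_univ P)] at hinj heA harb hcard
  have hS : S = univ := by
    rw [← card_eq_iff_eq_univ, hcard, card_univ, Fintype.card_fin]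
    omega
  subst hS
  have : Nonempty (Fin (Fintype.card V - 1)) := ⟨⟨0, by omega⟩⟩
  have hleft : Function.LeftInverse (Function.invFun e) e :=
    Function.leftInverse_invFun (Set.injOn_univ.1 (by simpa using hinj))
  refine ⟨univ.image e, s, harb, Function.invFun e, ?_, ?_⟩
  · intro x hx y hy hxy
    obtain ⟨i, -, rfl⟩ := mem_image.1 (mem_coe.1 hx)
    obtain ⟨j, -, rfl⟩ := mem_image.1 (mem_coe.1 hy)
    rw [hleft, hleft] at hxy
    rw [hxy]
  · rw [forall_mem_image]
    intro i hi
    rw [hleft]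
    exact heA i hi
end

section
/- Let G on vertex set V (|V| = n ≥ 2) be the disjoint union of n−1 spanning arborescences A_1,...,A_{n−1}. If at most two vertices of V are roots of two or more of the arborescences A_i (i.e., there are at most two multi-roots), then G contains a rainbow spanning arborescence. -/
open Finset

variable {V : Type*}

section RainbowTrees

variable {K : Type*} [DecidableEq K]

/-- `RainbowWalk arc C x y`: there is a walk from `x` to `y` that uses every color of `C` exactly
once and no other color, where `arc c` is the arc relation of the color `c`. -/
inductive RainbowWalk (arc : K → V → V → Prop) : Finset K → V → V → Prop
  | nil (x : V) : RainbowWalk arc ∅ x x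
  | cons {c : K} {C : Finset K} {x y z : V} :
      arc c x y → c ∉ C → RainbowWalk arc C y z → RainbowWalk arc (insert c C) x z

theorem RainbowWalk.append {arc : K → V → V → Prop} {C D : Finset K} {x y z : V}
    (h : RainbowWalk arc C x y) (h' : RainbowWalk arc D y z) (hCD : Disjoint C D) :
    RainbowWalk arc (C ∪ D) x z := by
  induction h with
  | nil x => simpa using h'
  | cons ha hc _ ih =>
    rw [Finset.disjoint_insert_left] at hCD
    rw [Finset.insert_union]
    exact .cons ha (by simp [hc, hCD.1]) (ih h' hCD.2)

theorem RainbowWalk.single {arc : K → V → V → Prop} {c : K} {x y : V} (h : arc c x y) :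
    RainbowWalk arc {c} x y := by
  simpa using RainbowWalk.cons h (Finset.notMem_empty c) (.nil y)

open Classical in
/-- The vertices from which `v` can be reached by a rainbow walk with colors in `C`. -/
noncomputable def rainbowAncestors [Fintype V] (arc : K → V → V → Prop) (C : Finset K) (v : V) :
    Finset V :=
  Finset.univ.filter fun x => ∃ D ⊆ C, RainbowWalk arc D x v

theorem mem_rainbowAncestors [Fintype V] {arc : K → V → V → Prop} {C : Finset K} {v x : V} :
    x ∈ rainbowAncestors arc C v ↔ ∃ D ⊆ C, RainbowWalk arc D x v := by
  simp [rainbowAncestors]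

theorem self_mem_rainbowAncestors [Fintype V] (arc : K → V → V → Prop) (C : Finset K) (v : V) :
    v ∈ rainbowAncestors arc C v :=
  mem_rainbowAncestors.2 ⟨∅, by simp, .nil v⟩

theorem rainbowAncestors_mono [Fintype V] (arc : K → V → V → Prop) {C D : Finset K} (h : C ⊆ D)
    (v : V) : rainbowAncestors arc C v ⊆ rainbowAncestors arc D v := fun x hx => by
  obtain ⟨E, hE, hw⟩ := mem_rainbowAncestors.1 hx
  exact mem_rainbowAncestors.2 ⟨E, hE.trans h, hw⟩

variable [DecidableEq V]

/-- If no color of `C` has its root among the ancestors of `v`, then `v` has more than `|C|`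
ancestors: otherwise a rainbow tree grown from outside would have to reach `v`. -/
theorem card_lt_card_rainbowAncestors [Fintype V] {arc : K → V → V → Prop} {root : K → V}
    (hleave : ∀ c (S : Finset V), root c ∈ S → S ≠ univ → ∃ x ∈ S, ∃ y ∉ S, arc c x y)
    (C : Finset K) (v : V) (hC : ∀ c ∈ C, root c ∉ rainbowAncestors arc C v) :
    C.card < (rainbowAncestors arc C v).card := by
  by_contra! hle
  set X := rainbowAncestors arc C v with hX
  have grow : ∀ m ≤ X.card, ∃ T ⊆ X, ∃ D ⊆ C, T.card = m ∧ D.card = m ∧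
      ∀ t ∈ T, ∃ z ∉ X, ∃ E ⊆ D, RainbowWalk arc E z t := by
    intro m
    induction m with
    | zero => exact fun _ => ⟨∅, by simp, ∅, by simp, rfl, rfl, by simp⟩
    | succ m ih =>
      intro hm
      obtain ⟨T, hTX, D, hDC, hT, hD, hwalk⟩ := ih (by omega)
      obtain ⟨c, hcC, hcD⟩ := Finset.exists_mem_notMem_of_card_lt_card (show D.card < C.card by omega)
      obtain ⟨u, huX, huT⟩ := Finset.exists_mem_notMem_of_card_lt_card (show T.card < X.card by omega)
      obtain ⟨x, hx, y, hy, hxy⟩ := hleave c (X \ T)ᶜ (by simp [hC c hcC])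
        (fun h => by
          have : u ∈ (X \ T)ᶜ := h ▸ mem_univ u
          simp [huX, huT] at this)
      simp only [mem_compl, mem_sdiff, not_not, not_and] at hx hy
      rw [Classical.not_imp] at hy
      refine ⟨insert y T, Finset.insert_subset hy.1 hTX, insert c D,
        Finset.insert_subset hcC hDC, by simp [hy.2, hT], by simp [hcD, hD], ?_⟩
      intro t ht
      rcases Finset.mem_insert.1 ht with rfl | ht
      · by_cases hxX : x ∈ X
        · obtain ⟨z, hz, E, hE, hw⟩ := hwalk x (hx hxX)
          exact ⟨z, hz, E ∪ {c}, by
            rw [Finset.union_comm]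
            exact Finset.insert_subset_insert c hE, hw.append (.single hxy)
              (Finset.disjoint_singleton_right.2 fun h => hcD (hE h))⟩
        · exact ⟨x, hxX, {c}, by simp, .single hxy⟩
      · obtain ⟨z, hz, E, hE, hw⟩ := hwalk t ht
        exact ⟨z, hz, E, hE.trans (Finset.subset_insert c D), hw⟩
  obtain ⟨T, hTX, D, hDC, hT, -, hwalk⟩ := grow X.card le_rfl
  obtain rfl := Finset.eq_of_subset_of_card_le hTX hT.ge
  obtain ⟨z, hz, E, hE, hw⟩ := hwalk v (self_mem_rainbowAncestors arc C v)
  exact hz (mem_rainbowAncestors.2 ⟨E, hE.trans hDC, hw⟩)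

/-- If all roots other than `v` and `w` are simple, some vertex has color-disjoint rainbow walks
to `v` and to `w`. -/
theorem exists_disjoint_rainbowWalks [Fintype V] [Fintype K] {arc : K → V → V → Prop}
    {root : K → V}
    (hleave : ∀ c (S : Finset V), root c ∈ S → S ≠ univ → ∃ x ∈ S, ∃ y ∉ S, arc c x y)
    (hcard : Fintype.card V ≤ Fintype.card K + 1) {v w : V} (hvw : v ≠ w)
    (hroot : ∀ c d, root c = root d → root c ≠ v → root c ≠ w → c = d) :
    ∃ x C D, RainbowWalk arc C x v ∧ RainbowWalk arc D x w ∧ Disjoint C D := by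
  classical
  by_contra! hno
  have hdisj : ∀ C D : Finset K, Disjoint C D →
      Disjoint (rainbowAncestors arc C v) (rainbowAncestors arc D w) := by
    intro C D hCD
    refine Finset.disjoint_left.2 fun x hxC hxD => ?_
    obtain ⟨C', hC', hw⟩ := mem_rainbowAncestors.1 hxC
    obtain ⟨D', hD', hw'⟩ := mem_rainbowAncestors.1 hxD
    exact hno x C' D' hw hw' (Finset.disjoint_of_subset_left hC'
      (Finset.disjoint_of_subset_right hD' hCD))
  let good : Finset (Finset K × Finset K) := univ.filter fun p => Disjoint p.1 p.2 ∧
    (∀ c ∈ p.1, root c ∈ rainbowAncestors arc p.2 w) ∧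
    (∀ c ∈ p.2, root c ∈ rainbowAncestors arc p.1 v) ∧
    (∀ c, root c = w → c ∈ p.1) ∧ (∀ c, root c = v → c ∈ p.2)
  have hgood : good.Nonempty := by
    refine ⟨(univ.filter fun c => root c = w, univ.filter fun c => root c = v), ?_⟩
    simp only [good, mem_filter, mem_univ, true_and, imp_self, implies_true, and_true]
    refine ⟨Finset.disjoint_left.2 fun c hc hc' => ?_, ?_, ?_⟩
    · simp only [mem_filter, mem_univ, true_and] at hc hc'
      exact hvw (hc'.symm.trans hc)
    · intro c hc
      rw [hc]
      exact self_mem_rainbowAncestors ..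
    · intro c hc
      rw [hc]
      exact self_mem_rainbowAncestors ..
  obtain ⟨⟨C, D⟩, hCDgood, hmax⟩ :=
    Finset.exists_max_image good (fun p => p.1.card + p.2.card) hgood
  simp only [good, mem_filter, mem_univ, true_and] at hCDgood hmax
  obtain ⟨hCD, hC, hD, hCw, hDv⟩ := hCDgood
  have hXY := hdisj C D hCD
  set X := rainbowAncestors arc C v with hX
  set Y := rainbowAncestors arc D w with hY
  have hXcard : C.card < X.card := card_lt_card_rainbowAncestors hleave C v
    fun c hc h => Finset.disjoint_left.1 hXY h (hC c hc)
  have hYcard : D.card < Y.card := card_lt_card_rainbowAncestors hleave D w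
    fun c hc h => Finset.disjoint_left.1 hXY (hD c hc) h
  have hout : ∀ c ∈ (C ∪ D)ᶜ, root c ∈ (X ∪ Y)ᶜ := by
    intro c hc
    simp only [mem_compl, mem_union, not_or] at hc ⊢
    constructor
    · intro hcX
      have := hmax (C, insert c D) ⟨Finset.disjoint_insert_right.2 ⟨hc.1, hCD⟩,
        fun d hd => rainbowAncestors_mono arc (Finset.subset_insert c D) w (hC d hd),
        fun d hd => by
          rcases Finset.mem_insert.1 hd with rfl | hd
          · exact hcX
          · exact hD d hd, hCw, fun d hd => Finset.mem_insert_of_mem (hDv d hd)⟩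
      simp [Finset.card_insert_of_notMem hc.2] at this
    · intro hcY
      have := hmax (insert c C, D) ⟨Finset.disjoint_insert_left.2 ⟨hc.2, hCD⟩,
        fun d hd => by
          rcases Finset.mem_insert.1 hd with rfl | hd
          · exact hcY
          · exact hC d hd,
        fun d hd => rainbowAncestors_mono arc (Finset.subset_insert c C) v (hD d hd),
        fun d hd => Finset.mem_insert_of_mem (hCw d hd), hDv⟩
      simp [Finset.card_insert_of_notMem hc.1] at this
  have hinj : Set.InjOn root ((C ∪ D)ᶜ : Finset K) := by
    intro c hc d _ hcd
    have hc' : c ∉ C ∧ c ∉ D := by simpa using hc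
    exact hroot c d hcd (fun h => hc'.2 (hDv c h)) (fun h => hc'.1 (hCw c h))
  have h1 := Finset.card_le_card_of_injOn root hout hinj
  have h2 := Finset.card_compl_add_card (C ∪ D)
  have h3 := Finset.card_compl_add_card (X ∪ Y)
  rw [Finset.card_union_of_disjoint hCD] at h2
  rw [Finset.card_union_of_disjoint hXY] at h3
  omega

/-- A rainbow arborescence on `S` rooted at `s`, given by the parent `f x` of each `x ≠ s` and the
color `g x` of the arc entering `x`. -/
structure IsRainbowTree (arc : K → V → V → Prop) (S : Finset V) (s : V) (f : V → V) (g : V → K) :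
    Prop where
  root_mem : s ∈ S
  parent_mem : ∀ x ∈ S, x ≠ s → f x ∈ S
  parent_arc : ∀ x ∈ S, x ≠ s → arc (g x) (f x) x
  color_inj : Set.InjOn g (S.erase s)
  reachable : ∀ x ∈ S, Relation.ReflTransGen (fun a b => b ∈ S ∧ b ≠ s ∧ f b = a) s x

namespace IsRainbowTree

variable {arc : K → V → V → Prop} {S : Finset V} {s : V} {f : V → V} {g : V → K}

theorem singleton {L : Type*} {arc : L → V → V → Prop} (s : V) (f : V → V) (g : V → L) :
    IsRainbowTree arc {s} s f g where
  root_mem := by simp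
  parent_mem x hx hxs := absurd (Finset.mem_singleton.1 hx) hxs
  parent_arc x hx hxs := absurd (Finset.mem_singleton.1 hx) hxs
  color_inj := by simp
  reachable x hx := by
    rw [Finset.mem_singleton.1 hx]

theorem card_colors (h : IsRainbowTree arc S s f g) :
    ((S.erase s).image g).card + 1 = S.card := by
  rw [Finset.card_image_of_injOn h.color_inj, Finset.card_erase_add_one h.root_mem]

theorem image_update_of_notMem {T : Finset V} {y : V} (hy : y ∉ T) (g : V → K) (c : K) :
    T.image (Function.update g y c) = T.image g :=
  Finset.image_congr fun x hx => Function.update_of_ne (by rintro rfl; exact hy hx) _ _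

theorem injOn_update {T : Finset V} {y : V} {g : V → K} {c : K} (hg : Set.InjOn g T)
    (hy : y ∉ T) (hc : c ∉ T.image g) :
    Set.InjOn (Function.update g y c) (insert y T : Finset V) := by
  rw [Finset.coe_insert, Set.injOn_insert (by simpa using hy)]
  have heq : Set.EqOn (Function.update g y c) g T := fun x hx =>
    Function.update_of_ne (by rintro rfl; exact hy hx) _ _
  refine ⟨(Set.EqOn.injOn_iff heq).2 hg, ?_⟩
  rw [heq.image_eq]
  simpa using hc

theorem add_leaf (h : IsRainbowTree arc S s f g) {x y : V} {c : K} (hx : x ∈ S) (hy : y ∉ S)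
    (ha : arc c x y) (hc : c ∉ (S.erase s).image g) :
    IsRainbowTree arc (insert y S) s (Function.update f y x) (Function.update g y c) := by
  have hys : y ≠ s := by rintro rfl; exact hy h.root_mem
  have hne : ∀ z ∈ S, z ≠ y := by rintro z hz rfl; exact hy hz
  refine ⟨Finset.mem_insert_of_mem h.root_mem, ?_, ?_, ?_, ?_⟩
  · intro z hz hzs
    rcases Finset.mem_insert.1 hz with rfl | hz
    · simp [hx]
    · rw [Function.update_of_ne (hne z hz)]
      exact Finset.mem_insert_of_mem (h.parent_mem z hz hzs)
  · intro z hz hzs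
    rcases Finset.mem_insert.1 hz with rfl | hz
    · simpa using ha
    · rw [Function.update_of_ne (hne z hz), Function.update_of_ne (hne z hz)]
      exact h.parent_arc z hz hzs
  · rw [Finset.erase_insert_of_ne hys]
    exact injOn_update h.color_inj (by simp [hy]) hc
  · have key : ∀ z ∈ S, Relation.ReflTransGen
        (fun a b => b ∈ insert y S ∧ b ≠ s ∧ Function.update f y x b = a) s z := fun z hz =>
      Relation.ReflTransGen.mono (fun a b hab => ⟨Finset.mem_insert_of_mem hab.1, hab.2.1, by
        rw [Function.update_of_ne (hne b hab.1)]
        exact hab.2.2⟩) _ _ (h.reachable z hz)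
    intro z hz
    rcases Finset.mem_insert.1 hz with rfl | hz
    · exact (key x hx).tail ⟨hz, hys, by simp⟩
    · exact key z hz

/-- Adding an arc `(y, s)` into the root makes `y` the new root; the former arc into `y`, if any,
is dropped. -/
theorem reroot (h : IsRainbowTree arc S s f g) {y : V} {c : K} (hy : y ≠ s)
    (ha : arc c y s) (hc : c ∉ (S.erase s).image g) :
    IsRainbowTree arc (insert y S) y (Function.update f s y) (Function.update g s c) := by
  refine ⟨Finset.mem_insert_self y S, ?_, ?_, ?_, ?_⟩
  · intro z hz hzy
    by_cases hzs : z = s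
    · subst hzs
      simp
    · rw [Function.update_of_ne hzs]
      exact Finset.mem_insert_of_mem (h.parent_mem z (Finset.mem_of_mem_insert_of_ne hz hzy) hzs)
  · intro z hz hzy
    by_cases hzs : z = s
    · subst hzs
      simpa using ha
    · rw [Function.update_of_ne hzs, Function.update_of_ne hzs]
      exact h.parent_arc z (Finset.mem_of_mem_insert_of_ne hz hzy) hzs
  · refine (injOn_update h.color_inj (by simp) hc).mono ?_
    intro z hz
    simp only [Finset.coe_erase, Finset.coe_insert, Set.mem_sdiff, Set.mem_insert_iff,
      Finset.mem_coe, Set.mem_singleton_iff] at hz ⊢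
    tauto
  · have key : ∀ z, Relation.ReflTransGen (fun a b => b ∈ S ∧ b ≠ s ∧ f b = a) s z →
        Relation.ReflTransGen
          (fun a b => b ∈ insert y S ∧ b ≠ y ∧ Function.update f s y b = a) y z := by
      intro z hz
      induction hz with
      | refl => exact .single ⟨Finset.mem_insert_of_mem h.root_mem, hy.symm, by simp⟩
      | @tail a b _ hab ih =>
        by_cases hby : b = y
        · rw [hby]
        · exact ih.tail ⟨Finset.mem_insert_of_mem hab.1, hby, by
            rw [Function.update_of_ne hab.2.1]
            exact hab.2.2⟩
    intro z hz
    rcases Finset.mem_insert.1 hz with rfl | hz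
    · exact .refl
    · exact key z (h.reachable z hz)

/-- A rainbow tree can be extended along a rainbow walk that starts in it and uses only colors
not occurring in it. -/
theorem extend_along_walk {x y : V} {C : Finset K} (hw : RainbowWalk arc C x y)
    (h : IsRainbowTree arc S s f g) (hx : x ∈ S) (hC : Disjoint ((S.erase s).image g) C) :
    ∃ S' f' g', IsRainbowTree arc S' s f' g' ∧ S ⊆ S' ∧ y ∈ S' ∧
      (S'.erase s).image g' ⊆ (S.erase s).image g ∪ C := by
  induction hw generalizing S f g with
  | nil x => exact ⟨S, f, g, h, Finset.Subset.refl S, hx, Finset.subset_union_left⟩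
  | @cons c C x y z ha hc _ ih =>
    rw [Finset.disjoint_insert_right] at hC
    by_cases hy : y ∈ S
    · obtain ⟨S', f', g', h', hSS', hz, hcol⟩ := ih h hy hC.2
      exact ⟨S', f', g', h', hSS', hz,
        hcol.trans (Finset.union_subset_union_right (Finset.subset_insert c C))⟩
    · have hys : y ≠ s := by rintro rfl; exact hy h.root_mem
      have himg : ((insert y S).erase s).image (Function.update g y c) =
          insert c ((S.erase s).image g) := by
        rw [Finset.erase_insert_of_ne hys, Finset.image_insert, Function.update_self,
          image_update_of_notMem (by simp [hy])]
      obtain ⟨S', f', g', h', hSS', hz, hcol⟩ := ih (h.add_leaf hx hy ha hC.1)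
        (Finset.mem_insert_self y S)
        (by rw [himg]; exact Finset.disjoint_insert_left.2 ⟨hc, hC.2⟩)
      refine ⟨S', f', g', h', (Finset.subset_insert y S).trans hSS', hz, ?_⟩
      rw [himg] at hcol
      simpa [Finset.insert_union, Finset.union_insert] using hcol

/-- A rainbow tree containing every multiple root extends to a larger one unless it is
spanning. -/
theorem exists_card_lt [Fintype V] [Fintype K] {root : K → V}
    (hleave : ∀ c (S : Finset V), root c ∈ S → S ≠ univ → ∃ x ∈ S, ∃ y ∉ S, arc c x y)
    (hcard : Fintype.card V = Fintype.card K + 1)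
    (h : IsRainbowTree arc S s f g)
    (hroot : ∀ c d, root c = root d → root c ∉ S → c = d) (hS : S ≠ univ) :
    ∃ S' s' f' g', IsRainbowTree arc S' s' f' g' ∧ S ⊆ S' ∧ S.card < S'.card := by
  by_contra! hno
  have hused : ∀ {s f g}, IsRainbowTree arc S s f g → ∀ c, root c ∈ S →
      c ∈ (S.erase s).image g := by
    intro s f g h c hc
    by_contra hcu
    obtain ⟨x, hx, y, hy, hxy⟩ := hleave c S hc hS
    have := hno _ _ _ _ (h.add_leaf hx hy hxy hcu) (Finset.subset_insert y S)
    rw [Finset.card_insert_of_notMem hy] at this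
    omega
  set U := (S.erase s).image g with hU
  have hUcard : U.card + 1 = S.card := h.card_colors
  have hinj : Set.InjOn root (Uᶜ : Finset K) := fun c hc d _ hcd =>
    hroot c d hcd fun hcS => by simpa using absurd (hused h c hcS) (Finset.mem_compl.1 hc)
  have hmaps : ∀ c ∈ Uᶜ, root c ∈ Sᶜ := fun c hc =>
    Finset.mem_compl.2 fun hcS => Finset.mem_compl.1 hc (hused h c hcS)
  have hUc := Finset.card_compl_add_card U
  have hSc := Finset.card_compl_add_card S
  have hsurj : Uᶜ.image root = Sᶜ :=
    Finset.eq_of_subset_of_card_le (Finset.image_subset_iff.2 hmaps) (by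
      rw [Finset.card_image_of_injOn hinj]
      omega)
  have hUS : ∀ c ∈ U, root c ∈ S := by
    intro c hc
    by_contra hcS
    have : root c ∈ Uᶜ.image root := hsurj ▸ Finset.mem_compl.2 hcS
    obtain ⟨d, hd, hdc⟩ := Finset.mem_image.1 this
    obtain rfl := hroot c d hdc.symm hcS
    exact Finset.mem_compl.1 hd hc
  obtain ⟨t, ht⟩ : ∃ t, t ∉ S := by simpa [Finset.eq_univ_iff_forall] using hS
  have : t ∈ Uᶜ.image root := hsurj ▸ Finset.mem_compl.2 ht
  obtain ⟨c, hc, -⟩ := Finset.mem_image.1 this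
  have hcS : root c ∉ S := Finset.mem_compl.1 (hmaps c hc)
  obtain ⟨y, hy, s', hs', hys⟩ := hleave c ({s}ᶜ)
    (by simpa using fun hcs : root c = s => hcS (hcs ▸ h.root_mem))
    (fun heq => by simpa using heq.ge (mem_univ s))
  obtain rfl : s' = s := by simpa using hs'
  have hys' : y ≠ s' := by simpa using hy
  have h' := h.reroot hys' hys (Finset.mem_compl.1 hc)
  by_cases hyS : y ∈ S
  · rw [Finset.insert_eq_of_mem hyS] at h'
    have hgy : g y ∈ U := Finset.mem_image_of_mem g (by simp [hyS, hys'])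
    obtain ⟨z, hz, hzg⟩ := Finset.mem_image.1 (hused h' (g y) (hUS _ hgy))
    obtain ⟨hzy, hzS⟩ := Finset.mem_erase.1 hz
    by_cases hzs : z = s'
    · subst hzs
      rw [Function.update_self] at hzg
      exact Finset.mem_compl.1 hc (hzg ▸ hgy)
    · rw [Function.update_of_ne hzs] at hzg
      exact hzy (h.color_inj (by simp [hzS, hzs]) (by simp [hyS, hys']) hzg)
  · have := hno _ _ _ _ h' (Finset.subset_insert y S)
    rw [Finset.card_insert_of_notMem hyS] at this
    omega

theorem exists_spanning [Fintype V] [Fintype K] {root : K → V}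
    (hleave : ∀ c (S : Finset V), root c ∈ S → S ≠ univ → ∃ x ∈ S, ∃ y ∉ S, arc c x y)
    (hcard : Fintype.card V = Fintype.card K + 1)
    (h : IsRainbowTree arc S s f g)
    (hroot : ∀ c d, root c = root d → root c ∉ S → c = d) :
    ∃ s' f' g', IsRainbowTree arc univ s' f' g' := by
  induction hm : Fintype.card V - S.card using Nat.strong_induction_on generalizing S s f g with
  | _ m ih =>
    by_cases hS : S = univ
    · subst hS
      exact ⟨s, f, g, h⟩
    · obtain ⟨S', s', f', g', h', hSS', hlt⟩ := h.exists_card_lt hleave hcard hroot hS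
      have := Finset.card_le_univ S'
      exact ih _ (by omega) h' (fun c d hcd hc => hroot c d hcd fun hcS => hc (hSS' hcS)) rfl

end IsRainbowTree

/-- If all roots other than `v` and `w` are simple, there is a spanning rainbow tree. -/
theorem exists_spanning_isRainbowTree [Fintype V] [Fintype K] [Nonempty K]
    {arc : K → V → V → Prop} {root : K → V}
    (hleave : ∀ c (S : Finset V), root c ∈ S → S ≠ univ → ∃ x ∈ S, ∃ y ∉ S, arc c x y)
    (hcard : Fintype.card V = Fintype.card K + 1) {v w : V} (hvw : v ≠ w)
    (hroot : ∀ c d, root c = root d → root c ≠ v → root c ≠ w → c = d) :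
    ∃ s f g, IsRainbowTree arc univ s f g := by
  obtain ⟨x, C, D, hC, hD, hCD⟩ := exists_disjoint_rainbowWalks hleave hcard.le hvw hroot
  obtain ⟨S₁, f₁, g₁, h₁, hxS₁, hv, hcol⟩ := IsRainbowTree.extend_along_walk hC
    (.singleton x id fun _ => Classical.arbitrary K) (by simp) (by simp)
  obtain ⟨S₂, f₂, g₂, h₂, hSS, hw, -⟩ := IsRainbowTree.extend_along_walk hD h₁ (hxS₁ (by simp))
    (Finset.disjoint_of_subset_left (by simpa using hcol) hCD)
  exact h₂.exists_spanning hleave hcard fun c d hcd hc =>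
    hroot c d hcd (fun h => hc (h ▸ hSS hv)) (fun h => hc (h ▸ hw))

end RainbowTrees

theorem IsSpanningArbor.exists_arc_leaving [Fintype V] [DecidableEq V] {A : Finset (V × V)} {r : V}
    (hA : IsSpanningArbor A r) (S : Finset V) (hr : r ∈ S) (hS : S ≠ univ) :
    ∃ x ∈ S, ∃ y ∉ S, (x, y) ∈ A := by
  by_contra! hno
  refine hS (Finset.eq_univ_iff_forall.2 fun x => ?_)
  have hx := hA.2.2.2.2 x (mem_univ x)
  induction hx with
  | refl => exact hr
  | @tail a b _ hab ih =>
    by_contra hb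
    exact hno a ih b hb hab

theorem stmt7 [Fintype V] [DecidableEq V] (hn : 2 ≤ Fintype.card V)
    (A : Fin (Fintype.card V - 1) → Finset (V × V)) (r : Fin (Fintype.card V - 1) → V)
    (hA : ∀ i, IsSpanningArbor (A i) (r i))
    (hmr : (Finset.univ.filter
      (fun v : V => 2 ≤ (Finset.univ.filter (fun i => r i = v)).card)).card ≤ 2) :
    ∃ (B : Finset (V × V)) (r' : V), IsSpanningArbor B r' ∧ IsRainbowOf A B := by
  obtain ⟨P, hP, -, hPcard⟩ := Finset.exists_subsuperset_card_eq (Finset.subset_univ _) hmr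
    (by simpa using hn)
  obtain ⟨v, w, hvw, rfl⟩ := Finset.card_eq_two.1 hPcard
  have hroot : ∀ c d, r c = r d → r c ≠ v → r c ≠ w → c = d := by
    intro c d hcd hv hw
    by_contra hne
    have hmem : r c ∈ ({v, w} : Finset V) := hP (by
      simp only [mem_filter, mem_univ, true_and]
      rw [← Finset.card_pair hne]
      exact Finset.card_le_card (by simp [Finset.insert_subset_iff, hcd]))
    simp [hv, hw] at hmem
  have : Nonempty (Fin (Fintype.card V - 1)) := ⟨⟨0, by omega⟩⟩
  obtain ⟨s, f, g, h⟩ := exists_spanning_isRainbowTree (arc := fun c x y => (x, y) ∈ A c)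
    (root := r) (fun c S => (hA c).exists_arc_leaving S)
    (by rw [Fintype.card_fin]; omega) hvw hroot
  have hB : ∀ a b, (a, b) ∈ (univ.erase s).image (fun x => (f x, x)) ↔ b ≠ s ∧ f b = a := by
    intro a b
    simp [and_comm]
  refine ⟨(univ.erase s).image fun x => (f x, x), s, ⟨mem_univ s, by simp, ?_, ?_, ?_⟩,
    fun e => g e.2, ?_, ?_⟩
  · rintro ⟨a, b⟩ he
    exact ((hB a b).1 he).1
  · intro x _ hx
    refine Finset.card_eq_one.2 ⟨(f x, x), ?_⟩
    ext ⟨a, b⟩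
    rw [mem_filter, hB, mem_singleton, Prod.mk.injEq]
    grind
  · intro x _
    exact Relation.ReflTransGen.mono (fun a b hab => (hB a b).2 hab.2) _ _
      (h.reachable x (mem_univ x))
  · rintro ⟨a, b⟩ he ⟨a', b'⟩ he' hg
    obtain ⟨hb, rfl⟩ := (hB a b).1 he
    obtain ⟨hb', rfl⟩ := (hB a' b').1 he'
    obtain rfl : b = b' := h.color_inj (by simp [hb]) (by simp [hb']) hg
    rfl
  · rintro ⟨a, b⟩ he
    obtain ⟨hb, rfl⟩ := (hB a b).1 he
    exact h.parent_arc b (mem_univ b) hb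
end

section
/- Let n ≥ 3 and let G on vertex set V (|V| = n) be the disjoint union of n−2 spanning arborescences A_1,...,A_{n−2}. Then G contains a spanning arborescence using at most two arcs from each A_i. -/
open Finset

variable {V : Type*}

/-- Inside `W`, every proper subset containing `r` is left by some arc of `R`. -/
def LeavesCuts (R : V → V → Prop) (W : Finset V) (r : V) : Prop :=
  r ∈ W ∧ ∀ U ⊆ W, r ∈ U → U ≠ W → ∃ a ∈ U, ∃ b ∈ W, b ∉ U ∧ R a b

/-- `ColoredTree A r U u`: an arborescence rooted at `r` with vertex set `U` can be grown arc by
arc, using `u i` arcs of each color `i`. -/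
inductive ColoredTree [DecidableEq V] {ι : Type*} [DecidableEq ι] (A : ι → V → V → Prop) (r : V) :
    Finset V → (ι → ℕ) → Prop
  | root : ColoredTree A r {r} 0
  | grow {U : Finset V} {u : ι → ℕ} {i : ι} {a b : V} : ColoredTree A r U u → a ∈ U → b ∉ U →
      A i a b → ColoredTree A r (insert b U) (u + Pi.single i 1)

section ColoredTree

variable [DecidableEq V] {ι : Type*} [DecidableEq ι] {A : ι → V → V → Prop}

theorem ColoredTree.root_mem {r : V} {U : Finset V} {u : ι → ℕ} (h : ColoredTree A r U u) :
    r ∈ U := by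
  induction h with
  | root => simp
  | grow _ _ _ _ ih => exact mem_insert_of_mem ih

theorem ColoredTree.sum_add_one {r : V} {U : Finset V} {u : ι → ℕ} (h : ColoredTree A r U u)
    {C : Finset ι} (hC : ∀ i ∉ C, u i = 0) : ∑ i ∈ C, u i + 1 = U.card := by
  induction h with
  | root => simp
  | @grow U u i a b _ _ hb _ ih =>
    have hi : i ∈ C := by
      by_contra hi
      simpa using hC i hi
    have ih := ih fun j hj => by
      have := hC j hj
      simp only [Pi.add_apply] at this
      omega
    simp only [Pi.add_apply, sum_add_distrib, sum_pi_single', hi, if_true, card_insert_of_notMem hb]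
    omega

theorem add_single_le_two {u : ι → ℕ} (hu : ∀ i, u i ≤ 2) {i : ι} (hi : u i < 2) (j : ι) :
    (u + Pi.single i 1 : ι → ℕ) j ≤ 2 := by
  have := hu j
  by_cases h : j = i
  · subst h
    simp
    omega
  · simpa [h] using this

/-- Greedy growth: colors rooted inside the tree can be used up, two arcs each. -/
theorem ColoredTree.extend {r : V} {U W : Finset V} {u : ι → ℕ} (h : ColoredTree A r U u)
    (hUW : U ⊆ W) (hu : ∀ i, u i ≤ 2) {D : Finset ι} {s : ι → V}
    (hD : ∀ i ∈ D, LeavesCuts (A i) W (s i)) (hs : ∀ i ∈ D, s i ∈ U)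
    (hcard : W.card + ∑ i ∈ D, u i ≤ U.card + 2 * D.card) :
    ∃ u', ColoredTree A r W u' ∧ (∀ i, u' i ≤ 2) ∧ ∀ i ∉ D, u' i = u i := by
  induction hk : W.card - U.card generalizing U u with
  | zero =>
    obtain rfl := eq_of_subset_of_card_le hUW (by omega)
    exact ⟨u, h, hu, fun _ _ => rfl⟩
  | succ k ih =>
    obtain ⟨i, hi, hlt⟩ : ∃ i ∈ D, u i < 2 := by
      by_contra! hge
      have : D.card • 2 ≤ ∑ i ∈ D, u i := card_nsmul_le_sum D u 2 hge
      rw [smul_eq_mul] at this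
      omega
    obtain ⟨a, ha, b, hbW, hb, hab⟩ := (hD i hi).2 U hUW (hs i hi) (by rintro rfl; omega)
    obtain ⟨u', h', hu', heq⟩ := ih (h.grow ha hb hab) (insert_subset hbW hUW)
      (add_single_le_two hu hlt) (fun j hj => mem_insert_of_mem (hs j hj))
      (by
        simp only [Pi.add_apply, sum_add_distrib, sum_pi_single', hi, if_true,
          card_insert_of_notMem hb]
        omega)
      (by rw [card_insert_of_notMem hb]; omega)
    refine ⟨u', h', hu', fun j hj => ?_⟩
    have hne : j ≠ i := by rintro rfl; exact hj hi
    simp [heq j hj, hne]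

theorem exists_coloredTree_le_two (W : Finset V) (C : Finset ι) (s : ι → V) (hW : W.Nonempty)
    (hC : ∀ i ∈ C, LeavesCuts (A i) W (s i)) (h₁ : W.card ≤ C.card + 2)
    (h₂ : W.card ≤ 2 * C.card + 1) :
    ∃ r u, ColoredTree A r W u ∧ (∀ i, u i ≤ 2) ∧ ∀ i ∉ C, u i = 0 := by
  induction hn : W.card using Nat.strong_induction_on generalizing W C with
  | _ n ih =>
  subst hn
  let P : Finset V → Prop := fun U => ∃ r u, ColoredTree A r U u ∧ (∀ i, u i ≤ 2) ∧
    ∀ i ∉ C, u i = 0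
  classical
  obtain ⟨w₀, hw₀⟩ := hW
  have hne : (W.powerset.filter P).Nonempty :=
    ⟨{w₀}, by simpa [hw₀] using ⟨w₀, 0, ColoredTree.root, by simp, by simp⟩⟩
  obtain ⟨U, hU, hmax⟩ := exists_max_image _ card hne
  obtain ⟨hUW, r, u, htree, hu, hu0⟩ : U ⊆ W ∧ P U := by simpa using hU
  by_cases hUeq : U = W
  · subst hUeq
    exact ⟨r, u, htree, hu, hu0⟩
  let D := C.filter fun i => u i < 2
  have hDC : D ⊆ C := filter_subset _ _
  have hclosed : ∀ i ∈ D, ∀ a ∈ U, ∀ b ∈ W, b ∉ U → ¬ A i a b := by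
    intro i hi a ha b hbW hb hab
    obtain ⟨hiC, hlt⟩ := mem_filter.1 hi
    have hP : P (insert b U) := by
      refine ⟨r, _, htree.grow ha hb hab, add_single_le_two hu hlt, fun j hj => ?_⟩
      have hne : j ≠ i := by rintro rfl; exact hj hiC
      simp [hu0 j hj, hne]
    have := hmax (insert b U) (mem_filter.2 ⟨mem_powerset.2 (insert_subset hbW hUW), hP⟩)
    rw [card_insert_of_notMem hb] at this
    omega
  have hsU : ∀ i ∈ D, s i ∈ W \ U := by
    intro i hi
    refine mem_sdiff.2 ⟨(hC i (hDC hi)).1, fun hsi => ?_⟩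
    obtain ⟨a, ha, b, hbW, hb, hab⟩ := (hC i (hDC hi)).2 U hUW hsi hUeq
    exact hclosed i hi a ha b hbW hb hab
  have hcuts : ∀ i ∈ D, LeavesCuts (A i) (W \ U) (s i) := by
    intro i hi
    refine ⟨hsU i hi, fun X hX hsX hXne => ?_⟩
    obtain ⟨a, ha, b, hbW, hb, hab⟩ := (hC i (hDC hi)).2 (X ∪ U)
      (union_subset (hX.trans sdiff_subset) hUW) (mem_union_left _ hsX) (by
        rintro hXU
        apply hXne
        ext x
        have := @hX x
        grind)
    rw [mem_union, not_or] at hb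
    rcases mem_union.1 ha with ha | ha
    · exact ⟨a, ha, b, mem_sdiff.2 ⟨hbW, hb.2⟩, hb.1, hab⟩
    · exact (hclosed i hi a ha b hbW hb.2 hab).elim
  have hcardU : (W \ U).card + U.card = W.card := card_sdiff_add_card_eq_card hUW
  have hUpos : 0 < U.card := card_pos.2 ⟨r, htree.root_mem⟩
  have hUlt : U.card < W.card := card_lt_card (hUW.ssubset_of_ne hUeq)
  have hDcard : W.card + (W \ U).card ≤ 2 * D.card + 3 := by
    have hsum := htree.sum_add_one hu0
    have hsplit : D.card + (C.filter fun i => ¬ u i < 2).card = C.card :=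
      card_filter_add_card_filter_not fun i => u i < 2
    have hle : (C.filter fun i => ¬ u i < 2).card * 2 ≤ ∑ i ∈ C, u i := by
      refine le_trans ?_ (sum_le_sum_of_subset (filter_subset (fun i => ¬ u i < 2) C))
      rw [← smul_eq_mul]
      refine card_nsmul_le_sum _ _ _ fun i hi => ?_
      exact not_lt.1 (mem_filter.1 hi).2
    omega
  rcases Nat.lt_or_ge (W \ U).card 2 with hm | hm
  · obtain ⟨w, hw⟩ := card_eq_one.1 (show (W \ U).card = 1 by omega)
    have hwW : w ∈ W := (mem_sdiff.1 (hw ▸ mem_singleton_self w)).1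
    have hsw : ∀ i ∈ D, s i = w := fun i hi => by simpa [hw] using hsU i hi
    by_cases hall : ∀ i ∈ C, s i = w
    · obtain ⟨u', h', hu', h0⟩ := (ColoredTree.root (A := A) (r := w)).extend (W := W)
        (by simpa using hwW) (by simp) hC (by simpa using hall) (by simp; omega)
      exact ⟨w, u', h', hu', h0⟩
    · push Not at hall
      obtain ⟨j, hj, hjw⟩ := hall
      obtain ⟨a, ha, b, hbW, hb, hab⟩ := (hC j hj).2 (W.erase w) (erase_subset _ _)
        (mem_erase.2 ⟨hjw, (hC j hj).1⟩) (fun h => erase_eq_self.1 h hwW)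
      obtain rfl : b = w := by
        by_contra hbw
        exact hb (mem_erase.2 ⟨hbw, hbW⟩)
      obtain ⟨hab', haW⟩ := mem_erase.1 ha
      have hjD : j ∉ D := fun h => hjw (hsw j h)
      have hba : b ∉ ({a} : Finset V) := by simpa using hab'.symm
      obtain ⟨u', h', hu', h0⟩ :=
        ((ColoredTree.root (A := A) (r := a)).grow (mem_singleton_self a) hba hab).extend (W := W)
          (insert_subset hbW (by simpa using haW)) (add_single_le_two (u := 0) (by simp) (by simp))
          (fun i hi => hC i (hDC hi)) (fun i hi => by simp [hsw i hi]) (by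
            rw [card_insert_of_notMem hba]
            simp [hjD]
            omega)
      refine ⟨a, u', h', hu', fun i hi => ?_⟩
      have hne : i ≠ j := by rintro rfl; exact hi hj
      simp [h0 i fun h => hi (hDC h), hne]
  · obtain ⟨r', v, hv, hv2, hv0⟩ := ih _ (by omega) (W \ U) D (card_pos.1 (by omega)) hcuts
      (by omega) (by omega) rfl
    have hsum := hv.sum_add_one hv0
    obtain ⟨u', h', hu', h0⟩ := hv.extend sdiff_subset hv2 (fun i hi => hC i (hDC hi)) hsU
      (by omega)
    exact ⟨r', u', h', hu', fun i hi => by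
      rw [h0 i fun h => hi (hDC h), hv0 i fun h => hi (hDC h)]⟩

theorem ColoredTree.exists_isArborOn [Nonempty ι] {r : V} {U : Finset V} {u : ι → ℕ}
    (h : ColoredTree A r U u) :
    ∃ (B : Finset (V × V)) (c : V × V → ι), IsArborOn U B r ∧ (∀ e ∈ B, A (c e) e.1 e.2) ∧
      ∀ i, (B.filter fun e => c e = i).card ≤ u i := by
  induction h with
  | root =>
    refine ⟨∅, fun _ => Classical.arbitrary ι, ⟨by simp, by simp, by simp, by simp, ?_⟩,
      by simp, by simp⟩
    intro v hv
    rw [mem_singleton.1 hv]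
  | @grow U u i a b htree ha hb hab ih =>
    obtain ⟨B, c, ⟨hr, hmem, hroot, hin, hreach⟩, hA, hcard⟩ := ih
    have hheads : ∀ e ∈ B, e.2 ≠ b := fun e he h => hb (h ▸ (hmem e he).2)
    have hnot : (a, b) ∉ B := fun h => hheads _ h rfl
    have hc : ∀ e ∈ B, Function.update c (a, b) i e = c e := fun e he =>
      Function.update_of_ne (by rintro rfl; exact hnot he) _ _
    refine ⟨insert (a, b) B, Function.update c (a, b) i,
      ⟨mem_insert_of_mem hr, ?_, ?_, ?_, ?_⟩, ?_, ?_⟩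
    · rintro e he
      rcases mem_insert.1 he with rfl | he
      · exact ⟨mem_insert_of_mem ha, mem_insert_self _ _⟩
      · exact ⟨mem_insert_of_mem (hmem e he).1, mem_insert_of_mem (hmem e he).2⟩
    · rintro e he
      rcases mem_insert.1 he with rfl | he
      · rintro rfl
        exact hb hr
      · exact hroot e he
    · intro v hv hvr
      rw [filter_insert]
      rcases mem_insert.1 hv with rfl | hv
      · rw [if_pos rfl, filter_eq_empty_iff.2 fun e he => hheads e he]
        simp
      · rw [if_neg (by rintro rfl; exact hb hv)]
        exact hin v hv hvr
    · have hmono : ∀ v ∈ U, Relation.ReflTransGen (fun x y => (x, y) ∈ insert (a, b) B) r v :=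
        fun v hv => Relation.ReflTransGen.mono (fun _ _ h => mem_insert_of_mem h) _ _ (hreach v hv)
      intro v hv
      rcases mem_insert.1 hv with rfl | hv
      · exact (hmono a ha).tail (mem_insert_self _ _)
      · exact hmono v hv
    · rintro e he
      rcases mem_insert.1 he with rfl | he
      · simpa using hab
      · rw [hc e he]
        exact hA e he
    · intro j
      rw [filter_insert, filter_congr fun e he => by rw [hc e he], Function.update_self]
      have := hcard j
      split_ifs with hij
      · subst hij
        refine (card_insert_le _ _).trans ?_
        simpa using this
      · exact this.trans (by simp)

theorem IsSpanningArbor.leavesCuts [Fintype V] {B : Finset (V × V)} {r : V}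
    (h : IsSpanningArbor B r) : LeavesCuts (fun a b => (a, b) ∈ B) univ r := by
  refine ⟨mem_univ _, fun U _ hr hU => ?_⟩
  by_contra! hno
  refine hU (eq_univ_iff_forall.2 fun v => ?_)
  induction h.2.2.2.2 v (mem_univ v) with
  | refl => exact hr
  | @tail x y _ hxy ih =>
    by_contra hy
    exact hno x ih y (mem_univ _) hy hxy

end ColoredTree

theorem stmt13 [Fintype V] [DecidableEq V] (hn : 3 ≤ Fintype.card V)
    (A : Fin (Fintype.card V - 2) → Finset (V × V)) (r : Fin (Fintype.card V - 2) → V)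
    (hA : ∀ i, IsSpanningArbor (A i) (r i)) :
    ∃ (B : Finset (V × V)) (r' : V) (c : V × V → Fin (Fintype.card V - 2)),
      IsSpanningArbor B r' ∧ (∀ e ∈ B, e ∈ A (c e)) ∧
      ∀ i, (B.filter (fun e => c e = i)).card ≤ 2 := by
  have : Nonempty (Fin (Fintype.card V - 2)) := ⟨⟨0, by omega⟩⟩
  obtain ⟨r', u, htree, hu, -⟩ := exists_coloredTree_le_two
    (A := fun i a b => (a, b) ∈ A i) univ univ r
    (card_pos.1 (by rw [card_univ]; omega)) (fun i _ => (hA i).leavesCuts)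
    (by simp only [card_univ, Fintype.card_fin]; omega)
    (by simp only [card_univ, Fintype.card_fin]; omega)
  obtain ⟨B, c, hB, hc, hcard⟩ := htree.exists_isArborOn
  exact ⟨B, r', c, hB, hc, fun i => (hcard i).trans (hu i)⟩
end

section
/- Let B̃_1 and B̃_2 be arc-disjoint in-arborescences in a digraph G, on vertex sets Ṽ_1 and Ṽ_2 respectively, rooted at x_1 and x_2 respectively. If Ṽ_1 ∩ Ṽ_2 ≠ ∅, then the union B̃_1 ∪ B̃_2 contains an arborescence whose vertex set contains both x_1 and x_2. -/
open Finset

variable {V : Type*}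

/-- `A` is the arc set of an in-arborescence on `U` rooted at `x`. -/
def IsInArborOn [DecidableEq V] (U : Finset V) (A : Finset (V × V)) (x : V) : Prop :=
  x ∈ U ∧ (∀ e ∈ A, e.1 ∈ U ∧ e.2 ∈ U) ∧ (∀ e ∈ A, e.1 ≠ x) ∧
  (∀ v ∈ U, v ≠ x → (A.filter (fun e => e.1 = v)).card = 1) ∧
  (∀ v ∈ U, Relation.ReflTransGen (fun a b => (a, b) ∈ A) v x)

/-- The arborescence with a single vertex and no arcs. -/
theorem isArborOn_singleton [DecidableEq V] (r : V) : IsArborOn {r} ∅ r := by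
  refine ⟨by simp, by simp, by simp, fun v hv hne => absurd (by simpa using hv) hne, ?_⟩
  intro v hv
  rw [Finset.mem_singleton.1 hv]

/-- Attaching a new leaf `c` below a vertex `b` of an arborescence gives an arborescence. -/
theorem IsArborOn.insert_leaf_s15 [DecidableEq V] {U : Finset V} {B : Finset (V × V)} {r b c : V}
    (h : IsArborOn U B r) (hb : b ∈ U) (hc : c ∉ U) :
    IsArborOn (insert c U) (insert (b, c) B) r := by
  obtain ⟨hr, hends, hroot, hdeg, hreach⟩ := h
  have hmono : ∀ v ∈ U, Relation.ReflTransGen (fun a d => (a, d) ∈ insert (b, c) B) r v :=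
    fun v hv => Relation.ReflTransGen.mono (fun _ _ => Finset.mem_insert_of_mem) _ _ (hreach v hv)
  refine ⟨Finset.mem_insert_of_mem hr, ?_, ?_, ?_, ?_⟩
  · intro e he
    rcases Finset.mem_insert.1 he with rfl | he
    · exact ⟨Finset.mem_insert_of_mem hb, Finset.mem_insert_self _ _⟩
    · exact ⟨Finset.mem_insert_of_mem (hends e he).1, Finset.mem_insert_of_mem (hends e he).2⟩
  · intro e he
    rcases Finset.mem_insert.1 he with rfl | he
    · rintro rfl
      exact hc hr
    · exact hroot e he
  · intro v hv hvr
    by_cases hvc : v = c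
    · subst hvc
      have hempty : B.filter (fun e => e.2 = v) = ∅ :=
        Finset.filter_eq_empty_iff.2 fun e he hev => hc (hev ▸ (hends e he).2)
      simp [Finset.filter_insert, hempty]
    · rw [Finset.filter_insert, if_neg (Ne.symm hvc)]
      exact hdeg v (Finset.mem_of_mem_insert_of_ne hv hvc) hvr
  · intro v hv
    rcases Finset.mem_insert.1 hv with rfl | hv
    · exact (hmono b hb).tail (Finset.mem_insert_self _ _)
    · exact hmono v hv

/-- An arborescence inside `A` can be enlarged, inside `A`, to contain any given vertex that is
reachable from its root through arcs of `A`. -/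
theorem IsArborOn.exists_extend [DecidableEq V] {A B : Finset (V × V)} {U : Finset V} {r x : V}
    (h : IsArborOn U B r) (hBA : B ⊆ A)
    (hx : Relation.ReflTransGen (fun a b => (a, b) ∈ A) r x) :
    ∃ (B' : Finset (V × V)) (U' : Finset V),
      B' ⊆ A ∧ IsArborOn U' B' r ∧ U ⊆ U' ∧ x ∈ U' := by
  induction hx with
  | refl => exact ⟨B, U, hBA, h, Finset.Subset.refl U, h.1⟩
  | @tail b c _ hbc ih =>
    obtain ⟨B', U', hB', harb, hU, hb⟩ := ih
    by_cases hc : c ∈ U'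
    · exact ⟨B', U', hB', harb, hU, hc⟩
    · exact ⟨insert (b, c) B', insert c U', Finset.insert_subset hbc hB',
        harb.insert_leaf_s15 hb hc, hU.trans (Finset.subset_insert _ _), Finset.mem_insert_self _ _⟩

theorem stmt15 [DecidableEq V]
    (B₁ B₂ : Finset (V × V)) (U₁ U₂ : Finset V) (x₁ x₂ : V)
    (hdisj : Disjoint B₁ B₂)
    (h₁ : IsInArborOn U₁ B₁ x₁) (h₂ : IsInArborOn U₂ B₂ x₂)
    (hcap : (U₁ ∩ U₂).Nonempty) :
    ∃ (B : Finset (V × V)) (U : Finset V) (r : V),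
      B ⊆ B₁ ∪ B₂ ∧ IsArborOn U B r ∧ x₁ ∈ U ∧ x₂ ∈ U := by
  obtain ⟨v, hv⟩ := hcap
  obtain ⟨hv₁, hv₂⟩ := Finset.mem_inter.1 hv
  have hreach₁ : Relation.ReflTransGen (fun a b => (a, b) ∈ B₁ ∪ B₂) v x₁ :=
    Relation.ReflTransGen.mono (fun _ _ => Finset.mem_union_left _) _ _ (h₁.2.2.2.2 v hv₁)
  have hreach₂ : Relation.ReflTransGen (fun a b => (a, b) ∈ B₁ ∪ B₂) v x₂ :=
    Relation.ReflTransGen.mono (fun _ _ => Finset.mem_union_right _) _ _ (h₂.2.2.2.2 v hv₂)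
  obtain ⟨B, U, hB, harb, -, hx₁⟩ :=
    (isArborOn_singleton v).exists_extend (Finset.empty_subset _) hreach₁
  obtain ⟨B', U', hB', harb', hU, hx₂⟩ := harb.exists_extend hB hreach₂
  exact ⟨B', U', v, hB', harb', hU hx₁, hx₂⟩
end
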